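/- Let p be a prime and r, s positive integers with s dividing r. Let N > 1 be an integer such that N − 1 divides p^{2r} − 1. Consider the cyclotomic cosets modulo N − 1 with respect to p^{2s}, with minimal representatives 0 = a_0 < a_1 < ⋯ < a_z. For 1 ≤ i ≤ z, let a_{N(i)} denote the minimal representative of the cyclotomic coset containing the residue of N − 1 − p^s·a_i modulo N − 1. Let t be an index with 1 ≤ t < z such that a_t < min { a_{N(i)} : 1 ≤ i ≤ t }. Put Δ = I_{a_1} ∪ I_{a_2} ∪ ⋯ ∪ I_{a_t} and let C = E_Δ ∩ F_{p^{2s}}^{N−1} be the subfield-subcode of the code E_Δ ⊆ F_{p^{2r}}^{N−1} (evaluation at the (N−1)-th roots of unity in F_{p^{2r}}). Then C ⊆ C^{⊥_h}, where ⊥_h is the Hermitian dual on F_{p^{2s}}^{N−1} given by x·_h y = Σ_i x_i y_i^{p^s}; dim_{F_{p^{2s}}} C = card(Δ); and every nonzero codeword of C^{⊥_h} has Hamming weight at least a_{t+1}. -/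

import Mathlib

/-- The set `U` of `n`-th roots of unity in `F` (the evaluation points). -/
def rootsSet (F : Type) [Field F] [Fintype F] [DecidableEq F] (n : ℕ) : Finset F :=
  Finset.univ.filter (fun α => α ^ n = 1)

/-- The evaluation code `E_Δ ⊆ F^{n}`: the `F`-span of the vectors `(α^d)_{α ∈ U}`, `d ∈ Δ`. -/
noncomputable def evalCode (F : Type) [Field F] [Fintype F] [DecidableEq F] (n : ℕ)
    (Δ : Set ℕ) : Submodule F (↥(rootsSet F n) → F) :=
  Submodule.span F { v | ∃ d ∈ Δ, v = fun α : ↥(rootsSet F n) => (α : F) ^ d }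

/-- The subfield-subcode `E_Δ ∩ F_{q₀}^n`. -/
noncomputable def subfieldSubcode (F : Type) [Field F] [Fintype F] [DecidableEq F]
    (n q₀ : ℕ) (Δ : Set ℕ) : Set (↥(rootsSet F n) → F) :=
  { v | v ∈ evalCode F n Δ ∧ ∀ i, v i ^ q₀ = v i }

/-- `x` is the minimal representative of its cyclotomic coset modulo `n`
with respect to `b`. -/
def IsMinRep (b n x : ℕ) : Prop :=
  x < n ∧ ∀ i : ℕ, x ≤ (x * b ^ i) % n

/-- The union `Δ = I_{a 1} ∪ ⋯ ∪ I_{a t}` of cyclotomic cosets. -/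
def unionCosets (b n t : ℕ) (a : ℕ → ℕ) : Set ℕ :=
  { x | ∃ i, 1 ≤ i ∧ i ≤ t ∧ ∃ k : ℕ, x = (a i * b ^ k) % n }

section CyclotomicCosets

theorem mul_pow_modEq_of_modEq_one {b n M : ℕ} (hM : b ^ M ≡ 1 [MOD n]) (x i : ℕ) :
    x * b ^ (M * i) ≡ x [MOD n] := by
  have h := (hM.pow i).mul_left x
  rwa [← pow_mul, one_pow, mul_one] at h

theorem mul_pow_mul_pow_modEq {b n M : ℕ} (hM0 : 0 < M) (hM : b ^ M ≡ 1 [MOD n]) (x i : ℕ) :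
    x * b ^ i * b ^ ((M - 1) * i) ≡ x [MOD n] := by
  have h : i + (M - 1) * i = M * i := by
    obtain ⟨m, rfl⟩ := Nat.exists_eq_succ_of_ne_zero hM0.ne'
    simp only [Nat.succ_eq_add_one, Nat.add_sub_cancel]
    ring
  rw [mul_assoc, ← pow_add, h]
  exact mul_pow_modEq_of_modEq_one hM x i

/-- Every residue lies in the cyclotomic coset of a minimal representative below it. -/
theorem exists_isMinRep {b n M : ℕ} (hM0 : 0 < M) (hM : b ^ M ≡ 1 [MOD n]) {x : ℕ} (hx : x < n) :
    ∃ y, IsMinRep b n y ∧ y ≤ x ∧ ∃ k, x = (y * b ^ k) % n := by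
  classical
  have hne : ∃ y, ∃ i, y = (x * b ^ i) % n := ⟨_, 0, rfl⟩
  obtain ⟨i, hi⟩ := Nat.find_spec hne
  have hmin : ∀ j, Nat.find hne ≤ (x * b ^ j) % n := fun j => Nat.find_min' hne ⟨j, rfl⟩
  have hmod : Nat.find hne ≡ x * b ^ i [MOD n] := by
    rw [hi]; exact Nat.mod_modEq _ _
  refine ⟨Nat.find hne, ⟨?_, fun j => ?_⟩, ?_, (M - 1) * i, ?_⟩
  · rw [hi]; exact Nat.mod_lt _ (by omega)
  · have h : (Nat.find hne * b ^ j) % n = (x * b ^ (i + j)) % n := by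
      rw [pow_add, ← mul_assoc]; exact hmod.mul_right _
    rw [h]; exact hmin _
  · simpa [Nat.mod_eq_of_lt hx] using hmin 0
  · have h := (hmod.mul_right (b ^ ((M - 1) * i))).trans (mul_pow_mul_pow_modEq hM0 hM x i)
    rw [h, Nat.mod_eq_of_lt hx]

/-- A minimal representative is at most every residue whose coset it shares. -/
theorem IsMinRep.le_of_modEq {b n M x y u v : ℕ} (hx : IsMinRep b n x) (hy : y < n)
    (hM0 : 0 < M) (hM : b ^ M ≡ 1 [MOD n]) (h : x * b ^ u ≡ y * b ^ v [MOD n]) : x ≤ y := by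
  have h2 := (h.mul_right (b ^ ((M - 1) * v))).trans (mul_pow_mul_pow_modEq hM0 hM y v)
  rw [mul_assoc, ← pow_add] at h2
  have h3 := hx.2 (u + (M - 1) * v)
  rwa [h2, Nat.mod_eq_of_lt hy] at h3

end CyclotomicCosets

section RootsOfUnity

variable (F : Type) [Field F] [Fintype F] [DecidableEq F]

theorem exists_isPrimitiveRoot_of_dvd_card_sub_one {n : ℕ} (h : n ∣ Fintype.card F - 1) :
    ∃ ζ : F, IsPrimitiveRoot ζ n := by
  obtain ⟨g, hg⟩ := IsCyclic.exists_ofOrder_eq_natCard (α := Fˣ)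
  rw [Nat.card_eq_fintype_card, Fintype.card_units] at hg
  obtain ⟨m, hm⟩ := h
  have hpos : 0 < Fintype.card F - 1 := by have := Fintype.one_lt_card (α := F); omega
  have hr : IsPrimitiveRoot (g : F) (Fintype.card F - 1) := by
    rw [IsPrimitiveRoot.coe_units_iff, ← hg]; exact IsPrimitiveRoot.orderOf g
  exact ⟨_, hr.pow hpos (by rw [hm, mul_comm])⟩

theorem card_rootsSet {n : ℕ} (hn : 0 < n) (h : n ∣ Fintype.card F - 1) :
    (rootsSet F n).card = n := by
  obtain ⟨ζ, hζ⟩ := exists_isPrimitiveRoot_of_dvd_card_sub_one F h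
  have hset : rootsSet F n = Polynomial.nthRootsFinset n (1 : F) := by
    ext x
    simp [rootsSet, Polynomial.mem_nthRootsFinset hn]
  rw [hset, hζ.card_nthRootsFinset]

variable {F}

theorem pow_eq_one_of_mem_rootsSet {n : ℕ} (α : ↥(rootsSet F n)) : (α : F) ^ n = 1 := by
  have h := α.2
  simpa [rootsSet] using h

theorem ne_zero_of_mem_rootsSet {n : ℕ} (hn : 0 < n) (α : ↥(rootsSet F n)) : (α : F) ≠ 0 := by
  intro h0
  have h := pow_eq_one_of_mem_rootsSet α
  rw [h0, zero_pow hn.ne'] at h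
  exact zero_ne_one h

theorem pow_mod_of_mem_rootsSet {n : ℕ} (α : ↥(rootsSet F n)) (e : ℕ) :
    (α : F) ^ (e % n) = (α : F) ^ e := by
  conv_rhs => rw [← Nat.mod_add_div e n, pow_add, pow_mul, pow_eq_one_of_mem_rootsSet, one_pow,
    mul_one]

theorem sum_pow_rootsSet_eq_zero {n e : ℕ} (h : n ∣ Fintype.card F - 1) (he : ¬ n ∣ e) :
    ∑ α : ↥(rootsSet F n), (α : F) ^ e = 0 := by
  obtain ⟨ζ, hζ⟩ := exists_isPrimitiveRoot_of_dvd_card_sub_one F h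
  have hζ1 : ζ ^ e ≠ 1 := fun h1 => he (hζ.dvd_of_pow_eq_one e h1)
  have hn : n ≠ 0 := by
    rintro rfl
    have := Fintype.one_lt_card (α := F)
    have := Nat.eq_zero_of_zero_dvd h
    omega
  have hζ0 : ζ ≠ 0 := hζ.ne_zero hn
  rw [Finset.sum_coe_sort (rootsSet F n) (fun α : F => α ^ e)]
  have key : ∑ α ∈ rootsSet F n, α ^ e = ζ ^ e * ∑ α ∈ rootsSet F n, α ^ e := by
    rw [Finset.mul_sum]
    refine Finset.sum_bij' (fun α _ => ζ⁻¹ * α) (fun α _ => ζ * α) ?_ ?_ ?_ ?_ ?_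
    · intro α hα
      simp only [rootsSet, Finset.mem_filter, Finset.mem_univ, true_and] at hα ⊢
      rw [mul_pow, inv_pow, hζ.pow_eq_one, hα]; simp
    · intro α hα
      simp only [rootsSet, Finset.mem_filter, Finset.mem_univ, true_and] at hα ⊢
      rw [mul_pow, hζ.pow_eq_one, hα]; simp
    · intro α _; simp [hζ0]
    · intro α _; simp [hζ0]
    · intro α _; rw [← mul_pow, mul_inv_cancel_left₀ hζ0]
  have h2 : (ζ ^ e - 1) * ∑ α ∈ rootsSet F n, α ^ e = 0 := by
    rw [sub_mul, one_mul, ← key, sub_self]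
  exact (mul_eq_zero.mp h2).resolve_left (sub_ne_zero.mpr hζ1)

end RootsOfUnity

section EvaluationCode

variable {F : Type} [Field F] [Fintype F] [DecidableEq F]

theorem pow_mem_evalCode {n d : ℕ} {Δ : Set ℕ} (hd : d ∈ Δ) :
    (fun α : ↥(rootsSet F n) => (α : F) ^ d) ∈ evalCode F n Δ :=
  Submodule.subset_span ⟨d, hd, rfl⟩

theorem linearIndependent_pow_rootsSet {n : ℕ} (hn : 0 < n) (h : n ∣ Fintype.card F - 1) :
    LinearIndependent F (fun (d : Fin n) (α : ↥(rootsSet F n)) => (α : F) ^ (d : ℕ)) := by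
  rw [Fintype.linearIndependent_iff]
  intro c hc
  let P : Polynomial F := ∑ d : Fin n, Polynomial.C (c d) * Polynomial.X ^ (d : ℕ)
  have hP : P = 0 := by
    refine Polynomial.eq_zero_of_natDegree_lt_card_of_eval_eq_zero' P (rootsSet F n) ?_ ?_
    · intro α hα
      have h1 := congrFun hc ⟨α, hα⟩
      simpa [P, Polynomial.eval_finsetSum] using h1
    · rw [card_rootsSet F hn h]
      refine lt_of_le_of_lt (Polynomial.natDegree_sum_le_of_forall_le (n := n - 1) _ _ ?_) (by omega)
      intro d _
      exact (Polynomial.natDegree_C_mul_X_pow_le _ _).trans (by have := d.2; omega)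
  intro d
  have h2 := congrArg (fun Q => Polynomial.coeff Q (d : ℕ)) hP
  simpa [P, Polynomial.finsetSum_coeff, Polynomial.coeff_X_pow, Fin.val_inj] using h2

theorem card_evalCode {n : ℕ} (hn : 0 < n) (h : n ∣ Fintype.card F - 1) {Δ : Set ℕ}
    (hΔ : ∀ d ∈ Δ, d < n) :
    Nat.card (evalCode F n Δ) = Nat.card F ^ Nat.card Δ := by
  have hfin : Finite Δ := (Set.finite_lt_nat n).subset hΔ
  have := Fintype.ofFinite Δ
  have hli : LinearIndependent F (fun (d : Δ) (α : ↥(rootsSet F n)) => (α : F) ^ (d : ℕ)) :=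
    (linearIndependent_pow_rootsSet hn h).comp (fun d : Δ => ⟨d, hΔ d d.2⟩)
      (fun d e hde => Subtype.ext (Fin.mk.inj_iff.mp hde))
  have hspan : evalCode F n Δ = Submodule.span F
      (Set.range (fun (d : Δ) (α : ↥(rootsSet F n)) => (α : F) ^ (d : ℕ))) := by
    rw [evalCode]
    congr 1
    ext v
    simp [eq_comm]
  rw [Module.natCard_eq_pow_finrank (K := F), hspan, finrank_span_eq_card hli,
    Nat.card_eq_fintype_card (α := Δ)]

theorem pow_comp_mem_evalCode {n q : ℕ} {Δ : Set ℕ} (hΔ : ∀ d ∈ Δ, (d * q) % n ∈ Δ)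
    (φ : F →+* F) (hφ : ∀ x, φ x = x ^ q) {v : ↥(rootsSet F n) → F} (hv : v ∈ evalCode F n Δ) :
    (fun α => v α ^ q) ∈ evalCode F n Δ := by
  simp only [← hφ]
  induction hv using Submodule.span_induction with
  | mem v hv =>
    obtain ⟨d, hd, rfl⟩ := hv
    convert pow_mem_evalCode (F := F) (n := n) (hΔ d hd) using 2 with α
    rw [hφ, pow_mod_of_mem_rootsSet, pow_mul]
  | zero =>
    simp only [Pi.zero_apply, map_zero]
    exact (evalCode F n Δ).zero_mem
  | add v w _ _ hv hw =>
    simp only [Pi.add_apply, map_add]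
    exact (evalCode F n Δ).add_mem hv hw
  | smul c v _ hv =>
    simp only [Pi.smul_apply, smul_eq_mul, map_mul]
    exact (evalCode F n Δ).smul_mem (φ c) hv

theorem pow_pow_comp_mem_evalCode {n q : ℕ} {Δ : Set ℕ} (hΔ : ∀ d ∈ Δ, (d * q) % n ∈ Δ)
    (φ : F →+* F) (hφ : ∀ x, φ x = x ^ q) {v : ↥(rootsSet F n) → F} (hv : v ∈ evalCode F n Δ)
    (i : ℕ) : (fun α => v α ^ q ^ i) ∈ evalCode F n Δ := by
  induction i with
  | zero => simpa using hv
  | succ i ih =>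
    simpa only [pow_succ, pow_mul] using pow_comp_mem_evalCode hΔ φ hφ ih

theorem sum_mul_eq_zero_of_mem_evalCode {n : ℕ} {Δ : Set ℕ} {u : ↥(rootsSet F n) → F}
    (hu : ∀ d ∈ Δ, ∑ α : ↥(rootsSet F n), (α : F) ^ d * u α = 0) {v : ↥(rootsSet F n) → F}
    (hv : v ∈ evalCode F n Δ) : ∑ α, v α * u α = 0 := by
  induction hv using Submodule.span_induction with
  | mem v hv =>
    obtain ⟨d, hd, rfl⟩ := hv
    exact hu d hd
  | zero => simp
  | add v w _ _ hv hw => simp only [Pi.add_apply, add_mul, Finset.sum_add_distrib, hv, hw, add_zero]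
  | smul c v _ hv => simp only [Pi.smul_apply, smul_eq_mul, mul_assoc, ← Finset.mul_sum, hv, mul_zero]

theorem sum_mul_pow_eq_zero_of_mem_evalCode {n q : ℕ} (hn : n ∣ Fintype.card F - 1) {Δ : Set ℕ}
    (φ : F →+* F) (hφ : ∀ x, φ x = x ^ q) (hΔ : ∀ d ∈ Δ, ∀ e ∈ Δ, ¬ n ∣ d + e * q)
    {v w : ↥(rootsSet F n) → F} (hv : v ∈ evalCode F n Δ) (hw : w ∈ evalCode F n Δ) :
    ∑ α, v α * w α ^ q = 0 := by
  refine sum_mul_eq_zero_of_mem_evalCode (fun d hd => ?_) hv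
  simp only [← hφ]
  induction hw using Submodule.span_induction with
  | mem w hw =>
    obtain ⟨e, he, rfl⟩ := hw
    simp only [hφ, ← pow_mul, ← pow_add]
    exact sum_pow_rootsSet_eq_zero hn (hΔ d hd e he)
  | zero => simp
  | add v w _ _ hv hw => simp only [Pi.add_apply, map_add, mul_add, Finset.sum_add_distrib, hv, hw, add_zero]
  | smul c v _ hv => simp only [Pi.smul_apply, smul_eq_mul, map_mul, mul_left_comm _ (φ c), ← Finset.mul_sum, hv,
      mul_zero]

/-- The BCH bound for the consecutive exponents `1, …, D - 1`. -/
theorem le_card_support_of_sum_pow_eq_zero {n D : ℕ} (hn : 0 < n) {u : ↥(rootsSet F n) → F}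
    (hu : ∀ d, 0 < d → d < D → ∑ α : ↥(rootsSet F n), (α : F) ^ d * u α = 0) (hu0 : u ≠ 0) :
    D ≤ (Finset.univ.filter (fun α => u α ≠ 0)).card := by
  by_contra! hlt
  obtain ⟨β, hβ⟩ := Function.ne_iff.mp hu0
  set S := Finset.univ.filter (fun α => u α ≠ 0) with hS
  have hβS : β ∈ S := by simpa [hS] using hβ
  let g : Polynomial F := ∏ γ ∈ S.erase β, (Polynomial.X - Polynomial.C (γ : F))
  let f : Polynomial F := Polynomial.X * g
  have hg : g.natDegree + 1 = S.card := by
    rw [Polynomial.natDegree_finsetProd_X_sub_C_eq_card, Finset.card_erase_of_mem hβS]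
    have := Finset.card_pos.mpr ⟨β, hβS⟩
    omega
  have hf : f.natDegree < D := by
    have : f.natDegree ≤ 1 + g.natDegree := Polynomial.natDegree_mul_le.trans (by simp)
    omega
  have hzero : ∑ α : ↥(rootsSet F n), f.eval (α : F) * u α = 0 := by
    simp only [Polynomial.eval_eq_sum_range, Finset.sum_mul]
    rw [Finset.sum_comm]
    refine Finset.sum_eq_zero fun d hd => ?_
    rcases Nat.eq_zero_or_pos d with rfl | hd0
    · simp [f]
    · simp only [mul_assoc, ← Finset.mul_sum]
      rw [hu d hd0 (by simp at hd; omega), mul_zero]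
  have hother : ∀ α, α ≠ β → f.eval (α : F) * u α = 0 := by
    intro α hα
    by_cases hα0 : u α = 0
    · rw [hα0, mul_zero]
    · have : g.eval (α : F) = 0 := by
        rw [Polynomial.eval_prod]
        exact Finset.prod_eq_zero (i := α) (by simp [hS, hα, hα0]) (by simp)
      simp [f, this]
  rw [Fintype.sum_eq_single β hother] at hzero
  refine mul_ne_zero ?_ hβ hzero
  have hgβ : g.eval (β : F) ≠ 0 := by
    rw [Polynomial.eval_prod, Finset.prod_ne_zero_iff]
    intro γ hγ
    have : (β : F) ≠ γ := fun h => (Finset.mem_erase.mp hγ).1 (Subtype.ext h.symm)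
    simpa [sub_eq_zero] using this
  simpa [f] using ⟨ne_zero_of_mem_rootsSet hn β, hgβ⟩

end EvaluationCode

section SubfieldSubcode

variable {F : Type} [Field F] [Fintype F] [DecidableEq F]

theorem natCard_subfield_of_mem_iff {q : ℕ} (hq : 1 < q) (hdvd : q - 1 ∣ Fintype.card F - 1)
    {K : Subfield F} (hK : ∀ x, x ∈ K ↔ x ^ q = x) : Nat.card K = q := by
  have hset : (K : Set F) = ↑(insert 0 (rootsSet F (q - 1))) := by
    ext x
    obtain ⟨m, rfl⟩ : ∃ m, q = m + 1 := ⟨q - 1, by omega⟩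
    by_cases hx : x = 0
    · simp [hx]
    · simp [hK, rootsSet, hx, pow_succ]
  have h0 : (0 : F) ∉ rootsSet F (q - 1) := by
    have : q - 1 ≠ 0 := by omega
    simp [rootsSet, this]
  have h1 : Nat.card K = Set.ncard (K : Set F) := rfl
  rw [h1, hset, Set.ncard_coe_finset, Finset.card_insert_of_notMem h0,
    card_rootsSet F (by omega) hdvd]
  omega

variable {K : Subfield F} {q n : ℕ} {Δ : Set ℕ}

theorem trace_comp_mem_subfieldSubcode (hK : ∀ x, x ∈ K ↔ x ^ q = x) (hcard : Nat.card K = q)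
    (φ : F →+* F) (hφ : ∀ x, φ x = x ^ q) (hΔ : ∀ d ∈ Δ, (d * q) % n ∈ Δ)
    {v : ↥(rootsSet F n) → F} (hv : v ∈ evalCode F n Δ) :
    (fun α => (Algebra.trace K F (v α) : F)) ∈ subfieldSubcode F n q Δ := by
  refine ⟨?_, fun α => (hK _).mp (Algebra.trace K F (v α)).2⟩
  have h : (fun α => (Algebra.trace K F (v α) : F)) =
      ∑ i ∈ Finset.range (Module.finrank K F), fun α => v α ^ q ^ i := by
    ext α
    have := FiniteField.algebraMap_trace_eq_sum_pow K F (v α)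
    rw [hcard] at this
    rw [Finset.sum_apply]
    exact this
  rw [h]
  exact Submodule.sum_mem _ fun i _ => pow_pow_comp_mem_evalCode hΔ φ hφ hv i

/-- Coordinates in a basis of `F` over the subfield split a Frobenius-stable evaluation code into
copies of its subfield-subcode. -/
theorem natCard_evalCode_eq_natCard_subfieldSubcode_pow (hK : ∀ x, x ∈ K ↔ x ^ q = x)
    (hcard : Nat.card K = q) (φ : F →+* F) (hφ : ∀ x, φ x = x ^ q)
    (hΔ : ∀ d ∈ Δ, (d * q) % n ∈ Δ) :
    Nat.card (evalCode F n Δ) = Nat.card (subfieldSubcode F n q Δ) ^ Module.finrank K F := by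
  let b := Module.finBasis K F
  let e : evalCode F n Δ ≃ (Fin (Module.finrank K F) → subfieldSubcode F n q Δ) :=
    { toFun := fun v i => ⟨fun α => (Algebra.trace K F (b i * v.1 α) : F),
        trace_comp_mem_subfieldSubcode hK hcard φ hφ hΔ ((evalCode F n Δ).smul_mem (b i) v.2)⟩
      invFun := fun c => ⟨∑ i, b.traceDual i • (c i).1,
        Submodule.sum_mem _ fun i _ => Submodule.smul_mem _ _ (c i).2.1⟩
      left_inv := by
        intro v
        ext α
        have h := b.traceDual.sum_repr (v.1 α)
        simp only [Module.Basis.traceDual_repr_apply, Algebra.traceForm_apply] at h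
        simp only [Finset.sum_apply, Pi.smul_apply, smul_eq_mul]
        rw [← h]
        refine Finset.sum_congr rfl fun i _ => ?_
        rw [h, Subfield.smul_def, smul_eq_mul, mul_comm, mul_comm (b i)]
      right_inv := by
        intro c
        ext i α
        let k : Fin (Module.finrank K F) → K := fun j => ⟨(c j).1 α, (hK _).mpr ((c j).2.2 α)⟩
        have h : Algebra.trace K F (b i * ∑ j, k j • b.traceDual j) = k i := by
          rw [Finset.mul_sum, map_sum]
          simp
        have hsum : (∑ j, b.traceDual j • (c j).1) α = ∑ j, k j • b.traceDual j := by
          simp [k, Finset.sum_apply, Subfield.smul_def, mul_comm]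
        simp only [hsum, h]
        rfl }
  rw [Nat.card_congr e, Nat.card_fun, Nat.card_fin]

theorem natCard_subfieldSubcode (hK : ∀ x, x ∈ K ↔ x ^ q = x)
    (hcard : Nat.card K = q) (φ : F →+* F) (hφ : ∀ x, φ x = x ^ q)
    (hΔ : ∀ d ∈ Δ, (d * q) % n ∈ Δ) (hlt : ∀ d ∈ Δ, d < n) (hn : 0 < n)
    (hdvd : n ∣ Fintype.card F - 1) :
    Nat.card (subfieldSubcode F n q Δ) = q ^ Nat.card Δ := by
  have h := natCard_evalCode_eq_natCard_subfieldSubcode_pow hK hcard φ hφ hΔ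
  rw [card_evalCode hn hdvd hlt, Module.natCard_eq_pow_finrank (K := K) (V := F), hcard,
    ← pow_mul, mul_comm, pow_mul] at h
  exact (Nat.pow_left_injective Module.finrank_pos.ne' h).symm

theorem sum_pow_mul_eq_zero_of_forall_subfieldSubcode (hK : ∀ x, x ∈ K ↔ x ^ q = x)
    (hcard : Nat.card K = q) (φ : F →+* F) (hφ : ∀ x, φ x = x ^ q)
    (hΔ : ∀ d ∈ Δ, (d * q) % n ∈ Δ) {u : ↥(rootsSet F n) → F} (huK : ∀ α, u α ∈ K)
    (hu : ∀ x ∈ subfieldSubcode F n q Δ, ∑ α, x α * u α = 0) {d : ℕ} (hd : d ∈ Δ) :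
    ∑ α : ↥(rootsSet F n), (α : F) ^ d * u α = 0 := by
  refine (traceForm_nondegenerate K F).1 _ fun c => ?_
  have h := hu _ (trace_comp_mem_subfieldSubcode hK hcard φ hφ hΔ
    ((evalCode F n Δ).smul_mem c (pow_mem_evalCode hd)))
  rw [Algebra.traceForm_apply, Finset.sum_mul, map_sum]
  apply Subtype.ext
  rw [ZeroMemClass.coe_zero, ← h, AddSubmonoidClass.coe_finsetSum]
  refine Finset.sum_congr rfl fun α _ => ?_
  have h1 : (α : F) ^ d * u α * c = (⟨u α, huK α⟩ : K) • (c * (α : F) ^ d) := by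
    rw [Subfield.smul_def, smul_eq_mul]; ring
  rw [h1, map_smul]
  simp [mul_comm]

end SubfieldSubcode

/-- Theorem 6 of the paper: Hermitian self-orthogonality, dimension
and designed distance for the subfield-subcode over `F_{p^{2s}}` of the univariate code
of length `N - 1` (with `N - 1 ∣ p^{2r} - 1`) given by the cyclotomic cosets (with
respect to `p^{2s}`) of the first `t` nonzero minimal representatives, where
`a t < min { a_{N(i)} : 1 ≤ i ≤ t }` and `a_{N(i)}` is the minimal representative of
the coset containing `N - 1 - p^s·a_i (mod N - 1)`. -/
theorem univariate_subfield_subcode_hermitian_minrep_condition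
    (p r s z t N : ℕ) (hp : p.Prime) (hs : 0 < s) (hsr : s ∣ r) (hr : 0 < r)
    (hN : 1 < N) (hNdvd : (N - 1) ∣ (p ^ (2 * r) - 1))
    (F : Type) [Field F] [Fintype F] [DecidableEq F]
    (hF : Fintype.card F = p ^ (2 * r))
    (a : ℕ → ℕ)
    (hmono : StrictMonoOn a (Set.Iic z))
    (hreps : ∀ x : ℕ, (∃ i ≤ z, a i = x) ↔ IsMinRep (p ^ (2 * s)) (N - 1) x)
    (aN : ℕ → ℕ)
    (haN : ∀ i, 1 ≤ i → i ≤ z →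
      IsMinRep (p ^ (2 * s)) (N - 1) (aN i) ∧
      ∃ k : ℕ, aN i =
        (((N - 1 - (p ^ s * a i) % (N - 1)) % (N - 1)) * (p ^ (2 * s)) ^ k) % (N - 1))
    (ht : 1 ≤ t) (htz : t < z)
    (hbound : ∀ i, 1 ≤ i → i ≤ t → a t < aN i) :
    (∀ x ∈ subfieldSubcode F (N - 1) (p ^ (2 * s))
        (unionCosets (p ^ (2 * s)) (N - 1) t a),
     ∀ y ∈ subfieldSubcode F (N - 1) (p ^ (2 * s))
        (unionCosets (p ^ (2 * s)) (N - 1) t a),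
      ∑ i, x i * y i ^ (p ^ s) = 0) ∧
    Nat.card (subfieldSubcode F (N - 1) (p ^ (2 * s))
        (unionCosets (p ^ (2 * s)) (N - 1) t a)) =
      (p ^ (2 * s)) ^ (Nat.card (unionCosets (p ^ (2 * s)) (N - 1) t a)) ∧
    (∀ y : ↥(rootsSet F (N - 1)) → F,
      (∀ i, y i ^ (p ^ (2 * s)) = y i) →
      (∀ x ∈ subfieldSubcode F (N - 1) (p ^ (2 * s))
          (unionCosets (p ^ (2 * s)) (N - 1) t a),
        ∑ i, x i * y i ^ (p ^ s) = 0) →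
      y ≠ 0 →
      a (t + 1) ≤ (Finset.univ.filter (fun i => y i ≠ 0)).card) := by
  have := Fact.mk hp
  have := charP_of_card_eq_prime_pow hF
  obtain ⟨m, rfl⟩ := hsr
  have hm : 0 < m := Nat.pos_of_mul_pos_left hr
  set n := N - 1 with hn
  set b := p ^ (2 * s) with hb
  set Δ := unionCosets b n t a with hΔdef
  have hn0 : 0 < n := by omega
  have hb1 : 1 < b := Nat.one_lt_pow (by omega) hp.one_lt
  have hbm : b ^ m = p ^ (2 * (s * m)) := by rw [hb, ← pow_mul, mul_assoc]
  have hdvd : n ∣ Fintype.card F - 1 := by rwa [hF]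
  have hM : b ^ m ≡ 1 [MOD n] := by
    rw [hbm]
    exact ((Nat.modEq_iff_dvd' (Nat.one_le_pow _ _ hp.pos)).mpr hNdvd).symm
  let φ : F →+* F := iterateFrobenius F p (2 * s)
  have hφ : ∀ x, φ x = x ^ b := fun x => iterateFrobenius_def p (2 * s) x
  let ψ : F →+* F := iterateFrobenius F p s
  have hψ : ∀ x, ψ x = x ^ p ^ s := fun x => iterateFrobenius_def p s x
  let K : Subfield F := φ.eqLocusField (RingHom.id F)
  have hK : ∀ x, x ∈ K ↔ x ^ b = x := fun x => by
    rw [RingHom.mem_eqLocusField, hφ, RingHom.id_apply]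
  have hcard : Nat.card K = b := by
    refine natCard_subfield_of_mem_iff hb1 ?_ hK
    rw [hF, ← hbm]
    simpa using Nat.sub_dvd_pow_sub_pow b 1 m
  have hΔlt : ∀ d ∈ Δ, d < n := by
    rintro d ⟨i, -, -, k, rfl⟩
    exact Nat.mod_lt _ hn0
  have hΔb : ∀ d ∈ Δ, (d * b) % n ∈ Δ := by
    rintro d ⟨i, h1, h2, k, rfl⟩
    exact ⟨i, h1, h2, k + 1, by rw [Nat.mod_mul_mod, pow_succ, mul_assoc]⟩
  have ha : ∀ i ≤ z, IsMinRep b n (a i) := fun i hi => (hreps _).mp ⟨i, hi, rfl⟩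
  have hΔorth : ∀ d ∈ Δ, ∀ e ∈ Δ, ¬ n ∣ d + e * p ^ s := by
    rintro d ⟨i, hi1, hit, k, rfl⟩ e ⟨j, hj1, hjt, l, rfl⟩ hdiv
    obtain ⟨hmin, w, hw⟩ := haN j hj1 (by omega)
    have hw0 : aN j + p ^ s * a j * b ^ w ≡ 0 [MOD n] := by
      have h1 : aN j ≡ (n - (p ^ s * a j) % n) * b ^ w [MOD n] := by
        rw [hw]
        exact (Nat.mod_modEq _ _).trans ((Nat.mod_modEq _ _).mul_right _)
      have h2 : p ^ s * a j * b ^ w ≡ (p ^ s * a j) % n * b ^ w [MOD n] :=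
        (Nat.mod_modEq _ _).symm.mul_right _
      refine (h1.add h2).trans ?_
      rw [← add_mul, Nat.sub_add_cancel (Nat.mod_lt _ hn0).le]
      exact (Nat.modEq_zero_iff_dvd).mpr (dvd_mul_right _ _)
    have hd0 : a i * b ^ k + a j * b ^ l * p ^ s ≡ 0 [MOD n] :=
      (((Nat.mod_modEq _ _).symm.add ((Nat.mod_modEq _ _).symm.mul_right _))).trans
        ((Nat.modEq_zero_iff_dvd).mpr hdiv)
    have hcoset : aN j * b ^ l ≡ a i * b ^ (k + w) [MOD n] := by
      have h1 := hw0.mul_right (b ^ l)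
      have h2 := hd0.mul_right (b ^ w)
      rw [zero_mul] at h1 h2
      refine Nat.ModEq.add_right_cancel' (p ^ s * a j * b ^ w * b ^ l) ?_
      have h3 := h1.trans h2.symm
      convert h3 using 1 <;> ring
    have hle := hmin.le_of_modEq (ha i (by omega)).1 hm hM hcoset
    have hai : a i ≤ a t := hmono.monotoneOn (by simp; omega) (by simp; omega) hit
    have := hbound j hj1 hjt
    omega
  have hconsec : ∀ d, 0 < d → d < a (t + 1) → d ∈ Δ := by
    intro d hd0 hd
    obtain ⟨y, hy, hyd, k, hk⟩ := exists_isMinRep hm hM (hd.trans (ha (t + 1) htz).1)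
    obtain ⟨i, hiz, rfl⟩ := (hreps y).mpr hy
    have hi : i < t + 1 :=
      (hmono.lt_iff_lt (by simpa using hiz) (by simpa using htz)).mp (hyd.trans_lt hd)
    refine ⟨i, Nat.one_le_iff_ne_zero.mpr ?_, by omega, k, hk⟩
    rintro rfl
    obtain ⟨j, hj, hj0⟩ := (hreps 0).mpr ⟨hn0, fun _ => Nat.zero_le _⟩
    have ha0 : a 0 ≤ a j := hmono.monotoneOn (by simp) (by simpa using hj) (Nat.zero_le j)
    have : a 0 = 0 := by omega
    simp [this] at hk
    omega
  refine ⟨fun x hx y hy => sum_mul_pow_eq_zero_of_mem_evalCode hdvd ψ hψ hΔorth hx.1 hy.1,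
    natCard_subfieldSubcode hK hcard φ hφ hΔb hΔlt hn0 hdvd, fun y hyK hy hy0 => ?_⟩
  have hps : p ^ s ≠ 0 := (pow_pos hp.pos s).ne'
  have huK : ∀ α, y α ^ p ^ s ∈ K := fun α => K.pow_mem ((hK _).mpr (hyK α)) _
  have hu0 : (fun α => y α ^ p ^ s) ≠ 0 := by
    obtain ⟨β, hβ⟩ := Function.ne_iff.mp hy0
    exact Function.ne_iff.mpr ⟨β, pow_ne_zero _ hβ⟩
  simpa only [ne_eq, pow_eq_zero_iff hps] using le_card_support_of_sum_pow_eq_zero hn0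
    (fun d hd0 hd => sum_pow_mul_eq_zero_of_forall_subfieldSubcode hK hcard φ hφ hΔb huK hy
      (hconsec d hd0 hd)) hu0
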